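/- Let ℋ be a finite-dimensional complex Hilbert space, ρ, σ nonzero PSD operators on ℋ, α ∈ (1,2], z > 0, and λ > 0 such that ρ^{α/z} ≤ λ σ^{α/z}. Then Q_{α,z}(ρ‖σ) = max{ α·Tr((ρ^{α/(2z)} H ρ^{α/(2z)})^{z/α}) + (1−α)·Tr((σ^{(α−1)/(2z)} H σ^{(α−1)/(2z)})^{z/(α−1)}) : H a nonzero PSD operator on ℋ }, and the same value is obtained as the maximum over H restricted to 0 ≤ H ≤ max{1,λ}·I, and also as the maximum over H restricted to 0 ≤ H ≤ λ^{α−1}·I; in particular all these maxima are attained. -/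

import Mathlib

open Filter Set Topology
open scoped ComplexOrder

noncomputable section

namespace QRenyi

attribute [local instance] Classical.propDecidable

variable {ι : Type*} [Fintype ι] [DecidableEq ι]

/-- Apply a real function to the eigenvalues of a Hermitian matrix (functional calculus);
junk value `0` for non-Hermitian matrices. -/
noncomputable def hermApply (f : ℝ → ℝ) (A : Matrix ι ι ℂ) : Matrix ι ι ℂ :=
  if hA : A.IsHermitian then hA.cfc f else 0

/-- Real power of a positive semidefinite matrix, taken on its support:
`t ↦ t ^ x` is applied to the nonzero eigenvalues and `0` is mapped to `0`.
In particular `matPow A 0` is the support projection of `A`. -/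
noncomputable def matPow (A : Matrix ι ι ℂ) (x : ℝ) : Matrix ι ι ℂ :=
  hermApply (fun t => if t = 0 then 0 else t ^ x) A

/-- Logarithm of a positive semidefinite matrix taken on its support
(`Real.log 0 = 0` in Mathlib, matching the convention `log̃ 0 = 0`). -/
noncomputable def matLog (A : Matrix ι ι ℂ) : Matrix ι ι ℂ :=
  hermApply Real.log A

/-- `supp ρ ≤ supp σ`, expressed (for PSD matrices) as inclusion of kernels. -/
def suppLE (ρ σ : Matrix ι ι ℂ) : Prop :=
  ∀ v : ι → ℂ, σ.mulVec v = 0 → ρ.mulVec v = 0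

/-- The Loewner (positive semidefinite) order. -/
def loewnerLE (A B : Matrix ι ι ℂ) : Prop := (B - A).PosSemidef

/-- Real part of the trace. -/
noncomputable def reTrace (A : Matrix ι ι ℂ) : ℝ := A.trace.re

/-- The trace quantity `Tr ((σ^{(1-α)/(2z)} ρ^{α/z} σ^{(1-α)/(2z)})^z)` (a real number). -/
noncomputable def Qaz (α z : ℝ) (ρ σ : Matrix ι ι ℂ) : ℝ :=
  reTrace (matPow (matPow σ ((1 - α) / (2 * z)) * matPow ρ (α / z) *
    matPow σ ((1 - α) / (2 * z))) z)

/-- The Rényi `(α,z)`-divergence (for `α ≠ 1`), with values in `EReal = ℝ ∪ {±∞}`.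
It equals `(α-1)⁻¹ (log Q_{α,z}(ρ‖σ) - log Tr ρ)`; it is `+∞` when `α > 1` and
`supp ρ ≰ supp σ`, and also `+∞` when `α < 1` and `Q_{α,z}(ρ‖σ) = 0`
(i.e. `(α-1)⁻¹ log 0 = +∞`). -/
noncomputable def Daz (α z : ℝ) (ρ σ : Matrix ι ι ℂ) : EReal :=
  if (suppLE ρ σ ∨ α < 1) ∧ Qaz α z ρ σ ≠ 0 then
    (((α - 1)⁻¹ * (Real.log (Qaz α z ρ σ) - Real.log (reTrace ρ)) : ℝ) : EReal)
  else ⊤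

/-- The (normalized) Umegaki relative entropy. -/
noncomputable def DUm (ρ σ : Matrix ι ι ℂ) : EReal :=
  if suppLE ρ σ then
    (((reTrace ρ)⁻¹ * reTrace (ρ * (matLog ρ - matLog σ)) : ℝ) : EReal)
  else ⊤

/-- The Rényi `(α,z)`-divergence, with `D_{1,z} := D^Um`. -/
noncomputable def Dfull (α z : ℝ) (ρ σ : Matrix ι ι ℂ) : EReal :=
  if α = 1 then DUm ρ σ else Daz α z ρ σ

/-- The max-relative entropy `D_max(ρ‖σ) = log inf {λ > 0 : ρ ≤ λ σ}`. -/
noncomputable def Dmax (ρ σ : Matrix ι ι ℂ) : EReal :=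
  if ∃ c : ℝ, 0 < c ∧ loewnerLE ρ (c • σ) then
    ((Real.log (sInf {c : ℝ | 0 < c ∧ loewnerLE ρ (c • σ)}) : ℝ) : EReal)
  else ⊤

/-- The classical quantity `Q_α^cl(ρ‖σ) = ∑_x ρ(x)^α σ(x)^{1-α}` (with `0^t = 0` for `t ≠ 0`). -/
noncomputable def Qcl {X : Type*} [Fintype X] (α : ℝ) (ρ σ : X → ℝ) : ℝ :=
  ∑ x, ρ x ^ α * σ x ^ (1 - α)

/-- Absolute continuity `ρ ≪ σ` for functions on a finite set. -/
def acl {X : Type*} (ρ σ : X → ℝ) : Prop := ∀ x, σ x = 0 → ρ x = 0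

/-- The classical Rényi `α`-divergence, with values in `EReal`; for `α = 1` it is the
(normalized) Kullback-Leibler divergence. -/
noncomputable def Dcl {X : Type*} [Fintype X] (α : ℝ) (ρ σ : X → ℝ) : EReal :=
  if α = 1 then
    (if acl ρ σ then
      ((((∑ x, ρ x)⁻¹ * ∑ x, ρ x * (Real.log (ρ x) - Real.log (σ x))) : ℝ) : EReal)
     else ⊤)
  else if (acl ρ σ ∨ α < 1) ∧ Qcl α ρ σ ≠ 0 then
    ((((α - 1)⁻¹ * (Real.log (Qcl α ρ σ) - Real.log (∑ x, ρ x))) : ℝ) : EReal)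
  else ⊤

/-- The measured Rényi `α`-divergence: supremum over all finite-outcome POVMs. -/
noncomputable def Dmeas (α : ℝ) (ρ σ : Matrix ι ι ℂ) : EReal :=
  ⨆ (k : ℕ) (M : Fin k → Matrix ι ι ℂ)
    (_ : (∀ i, (M i).PosSemidef) ∧ ∑ i, M i = 1),
    Dcl α (fun i => reTrace (M i * ρ)) (fun i => reTrace (M i * σ))

/-- A `κ`-function: a continuous nonnegative function on `[0,∞)` with
`limsup_{x→0⁺} f(x) x^{-κ} < ∞`. -/
def IsKappaFunction (κ : ℝ) (f : ℝ → ℝ) : Prop :=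
  ContinuousOn f (Set.Ici 0) ∧ (∀ x ∈ Set.Ici (0 : ℝ), 0 ≤ f x) ∧
    ∃ M : ℝ, ∀ᶠ x in 𝓝[>] (0 : ℝ), f x ≤ M * x ^ κ

/-- A strict `κ`-function: a `κ`-function with `liminf_{x→0⁺} f(x) x^{-κ} > 0`. -/
def IsStrictKappaFunction (κ : ℝ) (f : ℝ → ℝ) : Prop :=
  IsKappaFunction κ f ∧ ∃ c : ℝ, 0 < c ∧ ∀ᶠ x in 𝓝[>] (0 : ℝ), c * x ^ κ ≤ f x

/-- Nonzero PSD matrix predicate. -/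
def PSDne (A : Matrix ι ι ℂ) : Prop := A.PosSemidef ∧ A ≠ 0


/-- The functional appearing in the variational formula for `Q_{α,z}`. -/
noncomputable def varF {n : ℕ} (α z : ℝ) (ρ σ H : Matrix (Fin n) (Fin n) ℂ) : ℝ :=
  α * reTrace (matPow (matPow ρ (α / (2 * z)) * H * matPow ρ (α / (2 * z))) (z / α)) +
    (1 - α) * reTrace (matPow (matPow σ ((α - 1) / (2 * z)) * H *
      matPow σ ((α - 1) / (2 * z))) (z / (α - 1)))

section Auxiliary

open Matrix
open scoped MatrixOrder Matrix.Norms.L2Operator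

/-- The scalar function `t ↦ t ^ x` on nonzero `t`, sending `0` to `0`. -/
def supportPow (x t : ℝ) : ℝ := if t = 0 then 0 else t ^ x

lemma supportPow_eq_rpow {x : ℝ} (hx : x ≠ 0) (t : ℝ) : supportPow x t = t ^ x := by
  unfold supportPow
  split_ifs with h
  · rw [h, Real.zero_rpow hx]
  · rfl

lemma supportPow_nonneg (x : ℝ) {t : ℝ} (ht : 0 ≤ t) : 0 ≤ supportPow x t := by
  unfold supportPow
  split_ifs
  · rfl
  · positivity

lemma supportPow_mul_supportPow (x y : ℝ) {t : ℝ} (ht : 0 ≤ t) :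
    supportPow x t * supportPow y t = supportPow (x + y) t := by
  unfold supportPow
  split_ifs with h
  · simp
  · rw [Real.rpow_add (lt_of_le_of_ne ht (Ne.symm h))]

lemma supportPow_supportPow (x y : ℝ) {t : ℝ} (ht : 0 ≤ t) :
    supportPow y (supportPow x t) = supportPow (x * y) t := by
  unfold supportPow
  by_cases h : t = 0
  · simp [h]
  · have ht' : 0 < t := lt_of_le_of_ne ht (Ne.symm h)
    simp [h, (Real.rpow_pos_of_pos ht' x).ne', Real.rpow_mul ht]

lemma continuousOn_spectrum (f : ℝ → ℝ) (A : Matrix ι ι ℂ) : ContinuousOn f (spectrum ℝ A) :=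
  (A.finite_real_spectrum).continuousOn f

lemma matPow_eq_cfc {A : Matrix ι ι ℂ} (hA : A.IsHermitian) (x : ℝ) :
    matPow A x = cfc (supportPow x) A := by
  rw [hA.cfc_eq, matPow, hermApply, dif_pos hA]
  rfl

lemma spectrum_nonneg {A : Matrix ι ι ℂ} (hA : A.PosSemidef) {t : ℝ} (ht : t ∈ spectrum ℝ A) :
    0 ≤ t :=
  spectrum_nonneg_of_nonneg (nonneg_iff_posSemidef.mpr hA) ht

lemma posSemidef_matPow {A : Matrix ι ι ℂ} (hA : A.PosSemidef) (x : ℝ) :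
    (matPow A x).PosSemidef := by
  rw [matPow_eq_cfc hA.1, ← nonneg_iff_posSemidef]
  exact cfc_nonneg fun t ht => supportPow_nonneg x (spectrum_nonneg hA ht)

lemma matPow_mul_matPow {A : Matrix ι ι ℂ} (hA : A.PosSemidef) (x y : ℝ) :
    matPow A x * matPow A y = matPow A (x + y) := by
  simp only [matPow_eq_cfc hA.1]
  rw [← cfc_mul _ _ A (continuousOn_spectrum _ A) (continuousOn_spectrum _ A)]
  exact cfc_congr fun t ht => supportPow_mul_supportPow x y (spectrum_nonneg hA ht)

lemma matPow_smul_matPow {A : Matrix ι ι ℂ} (hA : A.PosSemidef) (x y : ℝ) {c : ℝ} (hc : 0 < c) :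
    matPow (c • matPow A x) y = c ^ y • matPow A (x * y) := by
  rw [matPow_eq_cfc ((posSemidef_matPow hA x).smul hc.le).1]
  simp only [matPow_eq_cfc hA.1]
  have h₁ : c • cfc (supportPow x) A = cfc (fun t => c • supportPow x t) A :=
    (cfc_smul c _ A (continuousOn_spectrum _ A)).symm
  have h₂ : c ^ y • cfc (supportPow (x * y)) A = cfc (fun t => c ^ y • supportPow (x * y) t) A :=
    (cfc_smul (c ^ y) _ A (continuousOn_spectrum _ A)).symm
  have h₃ : cfc (supportPow y) (cfc (fun t => c • supportPow x t) A) =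
      cfc (supportPow y ∘ fun t => c • supportPow x t) A :=
    (cfc_comp (supportPow y) (fun t => c • supportPow x t) A hA.1
      (((A.finite_real_spectrum).image _).continuousOn _) (continuousOn_spectrum _ A)).symm
  rw [h₁, h₂, h₃]
  refine cfc_congr fun t ht => ?_
  have ht0 := spectrum_nonneg hA ht
  simp only [smul_eq_mul, Function.comp_apply]
  rw [← supportPow_supportPow x y ht0]
  have hu := supportPow_nonneg x ht0
  generalize supportPow x t = u at hu
  unfold supportPow
  by_cases h : u = 0
  · simp [h]
  · simp [h, hc.ne', Real.mul_rpow hc.le hu]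

lemma matPow_matPow {A : Matrix ι ι ℂ} (hA : A.PosSemidef) (x y : ℝ) :
    matPow (matPow A x) y = matPow A (x * y) := by
  simpa using matPow_smul_matPow hA x y one_pos

lemma matPow_one {A : Matrix ι ι ℂ} (hA : A.PosSemidef) : matPow A 1 = A := by
  rw [matPow_eq_cfc hA.1]
  conv_rhs => rw [← cfc_id ℝ A hA.1]
  exact cfc_congr fun t _ => by simp [supportPow_eq_rpow]

lemma matPow_eq_cfc_rpow {A : Matrix ι ι ℂ} (hA : A.IsHermitian) {x : ℝ} (hx : x ≠ 0) :
    matPow A x = cfc (fun t : ℝ => t ^ x) A := by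
  rw [matPow_eq_cfc hA]
  exact cfc_congr fun t _ => supportPow_eq_rpow hx t

lemma matPow_zero_of_posDef {A : Matrix ι ι ℂ} (hA : A.PosDef) : matPow A 0 = 1 := by
  have h := matPow_mul_matPow hA.posSemidef 1 0
  rw [add_zero, matPow_one hA.posSemidef] at h
  exact hA.isUnit.mul_left_cancel (by rw [h, mul_one])

lemma matPow_mul_matPow_neg {A : Matrix ι ι ℂ} (hA : A.PosDef) (x : ℝ) :
    matPow A x * matPow A (-x) = 1 := by
  rw [matPow_mul_matPow hA.posSemidef, add_neg_cancel, matPow_zero_of_posDef hA]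

lemma posDef_matPow {A : Matrix ι ι ℂ} (hA : A.PosDef) (x : ℝ) : (matPow A x).PosDef :=
  ((posSemidef_matPow hA.posSemidef x).posDef_iff_isUnit).mpr
    (IsUnit.of_mul_eq_one _ (matPow_mul_matPow_neg hA x))

lemma inv_matPow {A : Matrix ι ι ℂ} (hA : A.PosDef) (x : ℝ) :
    (matPow A x)⁻¹ = matPow A (-x) :=
  Matrix.inv_eq_right_inv (matPow_mul_matPow_neg hA x)

lemma reTrace_mul_comm {κ : Type*} [Fintype κ] (A B : Matrix κ κ ℂ) :
    reTrace (A * B) = reTrace (B * A) := by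
  rw [reTrace, Matrix.trace_mul_comm, reTrace]

lemma reTrace_matPow {A : Matrix ι ι ℂ} (hA : A.IsHermitian) {x : ℝ} (hx : x ≠ 0) :
    reTrace (matPow A x) = ∑ i, hA.eigenvalues i ^ x := by
  rw [matPow_eq_cfc_rpow hA hx, hA.cfc_eq, IsHermitian.cfc, Unitary.conjStarAlgAut_apply,
    reTrace_mul_comm, ← mul_assoc]
  simp [reTrace, Matrix.trace]

/-- Intertwining of functional calculi: `Y f(Y* Y) = f(Y Y*) Y`. -/
lemma mul_cfc_conjTranspose_mul_self (f : ℝ → ℝ) (Y : Matrix ι ι ℂ) :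
    Y * cfc f (Yᴴ * Y) = cfc f (Y * Yᴴ) * Y := by
  let s : Finset ℝ := (Yᴴ * Y).finite_real_spectrum.toFinset ∪
    (Y * Yᴴ).finite_real_spectrum.toFinset
  let p : Polynomial ℝ := Lagrange.interpolate s id f
  have hp : ∀ t ∈ s, f t = p.eval t := fun t ht =>
    (Lagrange.eval_interpolate_at_node f (Set.injOn_id _) ht).symm
  have h₁ : cfc f (Yᴴ * Y) = Polynomial.aeval (Yᴴ * Y) p := by
    rw [← cfc_polynomial p (Yᴴ * Y) (isHermitian_conjTranspose_mul_self Y)]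
    exact cfc_congr fun t ht => hp t (by simp [s, ht])
  have h₂ : cfc f (Y * Yᴴ) = Polynomial.aeval (Y * Yᴴ) p := by
    rw [← cfc_polynomial p (Y * Yᴴ) (isHermitian_mul_conjTranspose_self Y)]
    exact cfc_congr fun t ht => hp t (by simp [s, ht])
  rw [h₁, h₂]
  generalize p = p
  induction p using Polynomial.induction_on' with
  | add p q hp hq => simp only [map_add, mul_add, add_mul, hp, hq]
  | monomial n a =>
    have hpow : Y * (Yᴴ * Y) ^ n = (Y * Yᴴ) ^ n * Y := by
      induction n with
      | zero => simp
      | succ n ih => rw [pow_succ, ← mul_assoc, ih, pow_succ]; simp only [mul_assoc]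
    simp [Polynomial.aeval_monomial, Algebra.algebraMap_eq_smul_one, hpow]

lemma mul_matPow_conjTranspose_mul_self (Y : Matrix ι ι ℂ) (x : ℝ) :
    Y * matPow (Yᴴ * Y) x = matPow (Y * Yᴴ) x * Y := by
  rw [matPow_eq_cfc (isHermitian_conjTranspose_mul_self Y),
    matPow_eq_cfc (isHermitian_mul_conjTranspose_self Y), mul_cfc_conjTranspose_mul_self]

lemma reTrace_matPow_conjTranspose_mul_self (Y : Matrix ι ι ℂ) (x : ℝ) :
    reTrace (matPow (Yᴴ * Y) x) = reTrace (matPow (Y * Yᴴ) x) := by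
  have h₁ := matPow_mul_matPow (posSemidef_conjTranspose_mul_self Y) 1 (x - 1)
  have h₂ := matPow_mul_matPow (posSemidef_self_mul_conjTranspose Y) (x - 1) 1
  rw [matPow_one (posSemidef_conjTranspose_mul_self Y), add_sub_cancel] at h₁
  rw [matPow_one (posSemidef_self_mul_conjTranspose Y), sub_add_cancel] at h₂
  rw [← h₁, ← h₂, mul_assoc, reTrace_mul_comm, mul_matPow_conjTranspose_mul_self, mul_assoc]

lemma matPow_le_matPow {A B : Matrix ι ι ℂ} (hA : A.PosSemidef) (hB : B.PosSemidef)
    (hAB : A ≤ B) {x : ℝ} (hx : 0 < x) (hx1 : x ≤ 1) : matPow A x ≤ matPow B x := by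
  rw [matPow_eq_cfc_rpow hA.1 hx.ne', matPow_eq_cfc_rpow hB.1 hx.ne',
    ← CFC.rpow_eq_cfc_real (nonneg_iff_posSemidef.mpr hA),
    ← CFC.rpow_eq_cfc_real (nonneg_iff_posSemidef.mpr hB)]
  exact CFC.rpow_le_rpow ⟨hx.le, hx1⟩ hAB

lemma continuous_reTrace_matPow {a : ℝ → Matrix ι ι ℂ} (ha : Continuous a)
    (hherm : ∀ t, (a t).IsHermitian) {x : ℝ} (hx : 0 < x) :
    Continuous fun t => reTrace (matPow (a t) x) := by
  have h : Continuous fun t => cfc (fun u : ℝ => u ^ x) (a t) :=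
    Continuous.cfc_of_mem_nhdsSet (s := Set.univ) _ Filter.univ_mem ha hherm
      (Real.continuous_rpow_const hx.le).continuousOn
  simp only [fun t => matPow_eq_cfc_rpow (hherm t) hx.ne', reTrace]
  exact Complex.continuous_re.comp h.matrix_trace

lemma rpow_apply_self_le {A : Matrix ι ι ℂ} (hA : A.PosSemidef) {q : ℝ} (hq : 1 ≤ q) :
    ∑ i, (A i i).re ^ q ≤ reTrace (matPow A q) := by
  have hU := hA.1.eigenvectorUnitary.2
  set U : Matrix ι ι ℂ := (hA.1.eigenvectorUnitary : Matrix ι ι ℂ) with hUdef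
  have hentry : ∀ i, (A i i).re = ∑ j, ‖U i j‖ ^ 2 * hA.1.eigenvalues j := by
    intro i
    conv_lhs => rw [hA.1.spectral_theorem, Unitary.conjStarAlgAut_apply]
    rw [← hUdef, Matrix.mul_apply, Complex.re_sum]
    refine Finset.sum_congr rfl fun j _ => ?_
    have hUU : U i j * star (U i j) = ((‖U i j‖ ^ 2 : ℝ) : ℂ) := by
      rw [← Complex.normSq_eq_norm_sq]
      exact Complex.mul_conj _
    rw [Matrix.mul_diagonal, star_eq_conjTranspose, conjTranspose_apply, mul_right_comm, hUU,
      Complex.re_ofReal_mul]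
    rfl
  have hrow : ∀ i, ∑ j, ‖U i j‖ ^ 2 = 1 := by
    intro i
    have h := congrFun (congrFun (mem_unitaryGroup_iff.mp hU) i) i
    rw [Matrix.mul_apply] at h
    simp only [star_eq_conjTranspose, conjTranspose_apply, RCLike.star_def, Complex.mul_conj,
      Complex.normSq_eq_norm_sq, one_apply_eq] at h
    exact_mod_cast h
  have hcol : ∀ j, ∑ i, ‖U i j‖ ^ 2 = 1 := by
    intro j
    have h := congrFun (congrFun (mem_unitaryGroup_iff'.mp hU) j) j
    rw [Matrix.mul_apply] at h
    simp only [star_eq_conjTranspose, conjTranspose_apply, RCLike.star_def, Complex.conj_mul',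
      one_apply_eq] at h
    exact_mod_cast h
  rw [reTrace_matPow hA.1 (by linarith)]
  calc ∑ i, (A i i).re ^ q
      ≤ ∑ i, ∑ j, ‖U i j‖ ^ 2 * hA.1.eigenvalues j ^ q := by
        refine Finset.sum_le_sum fun i _ => ?_
        rw [hentry]
        exact Real.rpow_arith_mean_le_arith_mean_rpow _ _ _ (fun j _ => by positivity) (hrow i)
          (fun j _ => hA.eigenvalues_nonneg j) hq
    _ = ∑ j, hA.1.eigenvalues j ^ q := by
        rw [Finset.sum_comm]
        simp only [← Finset.sum_mul, hcol, one_mul]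

section Triangular

variable {n : ℕ}

lemma isLowerTriangular_inv {T : Matrix (Fin n) (Fin n) ℂ} (hT : T.IsLowerTriangular)
    (hu : IsUnit T) : T⁻¹.IsLowerTriangular := by
  have := hu.invertible
  exact blockTriangular_inv_of_blockTriangular hT

lemma mul_apply_self_of_isLowerTriangular {R T : Matrix (Fin n) (Fin n) ℂ}
    (hR : R.IsLowerTriangular) (hT : T.IsLowerTriangular) (i : Fin n) :
    (R * T) i i = R i i * T i i := by
  rw [Matrix.mul_apply]
  refine Finset.sum_eq_single i (fun j _ hj => ?_) (by simp)
  rcases lt_or_gt_of_ne hj with h | h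
  · rw [hT (by exact h), mul_zero]
  · rw [hR (by exact h), zero_mul]

lemma apply_self_mul_inv_apply_self {T : Matrix (Fin n) (Fin n) ℂ} (hT : T.IsLowerTriangular)
    (hu : IsUnit T) (i : Fin n) : T i i * T⁻¹ i i = 1 := by
  rw [← mul_apply_self_of_isLowerTriangular hT (isLowerTriangular_inv hT hu),
    Matrix.mul_nonsing_inv _ ((Matrix.isUnit_iff_isUnit_det _).mp hu), one_apply_eq]

/-- Cholesky factorization. -/
lemma exists_isLowerTriangular_mul_conjTranspose {C : Matrix (Fin n) (Fin n) ℂ}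
    (hC : C.PosDef) :
    ∃ T : Matrix (Fin n) (Fin n) ℂ, T.IsLowerTriangular ∧ IsUnit T ∧ T * Tᴴ = C := by
  have hLu : IsUnit (LDL.lowerInv hC) := isUnit_of_invertible _
  have hL : (LDL.lowerInv hC).IsLowerTriangular := fun i j hij => LDL.lowerInv_triangular hC hij
  have hD : (diagonal (LDL.diagEntries hC)).PosDef := by
    have h := LDL.diag_eq_lowerInv_conj hC
    rw [LDL.diag] at h
    rw [h]
    exact hC.mul_mul_conjTranspose_same (Matrix.vecMul_injective_of_isUnit hLu)
  have hpos : ∀ i, 0 < LDL.diagEntries hC i := posDef_diagonal_iff.mp hD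
  let d : Fin n → ℂ := fun i => (Real.sqrt (LDL.diagEntries hC i).re : ℂ)
  have hd : ∀ i, d i * star (d i) = LDL.diagEntries hC i := by
    intro i
    obtain ⟨h₁, h₂⟩ := Complex.lt_def.mp (hpos i)
    simp only [d, RCLike.star_def, Complex.conj_ofReal]
    rw [← Complex.ofReal_mul, Real.mul_self_sqrt h₁.le]
    exact Complex.ext rfl h₂
  have hmul : LDL.lower hC * diagonal d * (LDL.lower hC * diagonal d)ᴴ = C := by
    conv_rhs => rw [← LDL.lower_conj_diag hC]
    rw [conjTranspose_mul, diagonal_conjTranspose, LDL.diag, mul_assoc, ← mul_assoc (diagonal d),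
      diagonal_mul_diagonal, mul_assoc]
    simp only [Pi.star_apply, hd]
  refine ⟨LDL.lower hC * diagonal d, ?_, ?_, hmul⟩
  · exact (isLowerTriangular_inv hL hLu).mul (blockTriangular_diagonal d)
  · exact isUnit_of_mul_isUnit_left (by rw [hmul]; exact hC.isUnit)

lemma norm_sq_le_re_conjTranspose_mul_self_apply {κ : Type*} [Fintype κ] (R : Matrix κ κ ℂ)
    (i : κ) :
    ‖R i i‖ ^ 2 ≤ ((Rᴴ * R) i i).re := by
  rw [Matrix.mul_apply, Complex.re_sum]
  have h : ∀ j, ((Rᴴ i j) * R j i).re = ‖R j i‖ ^ 2 := fun j => by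
    rw [conjTranspose_apply, RCLike.star_def, Complex.conj_mul', ← Complex.ofReal_pow,
      Complex.ofReal_re]
  simp only [h]
  exact Finset.single_le_sum (f := fun j => ‖R j i‖ ^ 2) (fun j _ => by positivity)
    (Finset.mem_univ i)

lemma mul_rpow_add_le {x t q : ℝ} (hx : 0 ≤ x) (ht : 0 < t) (hq : 0 < q) (hq1 : q < 1) :
    x ^ q ≤ q * (x * t) + (1 - q) * t⁻¹ ^ (q / (1 - q)) := by
  have h := Real.geom_mean_le_arith_mean2_weighted hq.le (sub_nonneg.mpr hq1.le)
    (mul_nonneg hx ht.le) (Real.rpow_nonneg (inv_nonneg.mpr ht.le) (q / (1 - q))) (by ring)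
  refine le_trans (le_of_eq ?_) h
  rw [← Real.rpow_mul (by positivity), div_mul_cancel₀ _ (by linarith), ← Real.mul_rpow
    (by positivity) (by positivity), mul_assoc, mul_inv_cancel₀ ht.ne', mul_one]

/-- Weyl's majorant inequality for triangular matrices, for exponents at least `1 / (k + 1)`. -/
lemma weyl_le_of_inv_le (k : ℕ) : ∀ {q : ℝ}, 0 < q → 1 ≤ (k + 1) * q →
    ∀ {R : Matrix (Fin n) (Fin n) ℂ}, R.IsLowerTriangular → IsUnit R →
      ∑ i, (‖R i i‖ ^ 2) ^ q ≤ reTrace (matPow (Rᴴ * R) q) := by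
  induction k with
  | zero =>
    intro q hq0 hq R _ _
    refine le_trans (Finset.sum_le_sum fun i _ => ?_)
      (rpow_apply_self_le (posSemidef_conjTranspose_mul_self R) (by simpa using hq))
    exact Real.rpow_le_rpow (by positivity) (norm_sq_le_re_conjTranspose_mul_self_apply R i) hq0.le
  | succ k ih =>
    intro q hq0 hq R hR hRu
    rcases le_or_gt 1 ((k + 1) * q) with hk | hk
    · exact ih hq0 hk hR hRu
    have hq1 : q < 1 := by nlinarith [(Nat.cast_nonneg k : (0 : ℝ) ≤ k)]
    have hN : (Rᴴ * R).PosDef :=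
      PosDef.conjTranspose_mul_self R (Matrix.mulVec_injective_of_isUnit hRu)
    obtain ⟨T, hT, hTu, hTC⟩ :=
      exists_isLowerTriangular_mul_conjTranspose (posDef_matPow hN (q - 1))
    have hTu' : IsUnit T⁻¹ := (Matrix.isUnit_nonsing_inv_iff).mpr hTu
    have h₁ : ∑ i, ‖R i i‖ ^ 2 * ‖T i i‖ ^ 2 ≤ reTrace (matPow (Rᴴ * R) q) := by
      have htr : reTrace ((R * T)ᴴ * (R * T)) = reTrace (matPow (Rᴴ * R) q) := by
        have h := matPow_mul_matPow hN.posSemidef (q - 1) 1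
        rw [matPow_one hN.posSemidef, sub_add_cancel, ← hTC] at h
        rw [← h, conjTranspose_mul, mul_assoc, reTrace_mul_comm, mul_assoc, mul_assoc, mul_assoc,
          ← mul_assoc T Tᴴ, ← mul_assoc, reTrace_mul_comm]
      rw [← htr, reTrace, Matrix.trace, Complex.re_sum]
      refine Finset.sum_le_sum fun i _ => ?_
      rw [← mul_pow, ← norm_mul, ← mul_apply_self_of_isLowerTriangular hR hT]
      exact norm_sq_le_re_conjTranspose_mul_self_apply _ i
    have h₂ : ∑ i, (‖T⁻¹ i i‖ ^ 2) ^ (q / (1 - q)) ≤ reTrace (matPow (Rᴴ * R) q) := by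
      have h := ih (q := q / (1 - q)) (div_pos hq0 (by linarith)) ?_ (isLowerTriangular_inv hT hTu)
        hTu'
      · rwa [conjTranspose_nonsing_inv, ← Matrix.mul_inv_rev, hTC, inv_matPow hN,
          matPow_matPow hN.posSemidef, neg_sub, mul_div_cancel₀ _ (by linarith)] at h
      · rw [← mul_div_assoc, le_div_iff₀ (by linarith)]
        push_cast at hq
        linarith
    have h₃ : ∀ i, (‖R i i‖ ^ 2) ^ q ≤ q * (‖R i i‖ ^ 2 * ‖T i i‖ ^ 2) +
        (1 - q) * (‖T⁻¹ i i‖ ^ 2) ^ (q / (1 - q)) := by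
      intro i
      have hi := apply_self_mul_inv_apply_self hT hTu i
      have hne : T i i ≠ 0 := left_ne_zero_of_mul_eq_one hi
      have hinv : ‖T⁻¹ i i‖ ^ 2 = (‖T i i‖ ^ 2)⁻¹ := by
        rw [eq_inv_of_mul_eq_one_right hi, norm_inv, inv_pow]
      rw [hinv]
      exact mul_rpow_add_le (by positivity) (by positivity) hq0 hq1
    calc ∑ i, (‖R i i‖ ^ 2) ^ q
        ≤ q * ∑ i, ‖R i i‖ ^ 2 * ‖T i i‖ ^ 2 +
            (1 - q) * ∑ i, (‖T⁻¹ i i‖ ^ 2) ^ (q / (1 - q)) := by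
          rw [Finset.mul_sum, Finset.mul_sum, ← Finset.sum_add_distrib]
          exact Finset.sum_le_sum fun i _ => h₃ i
      _ ≤ reTrace (matPow (Rᴴ * R) q) := by nlinarith

/-- Weyl's majorant inequality for triangular matrices. -/
lemma sum_norm_sq_rpow_le_reTrace {q : ℝ} (hq : 0 < q) {R : Matrix (Fin n) (Fin n) ℂ}
    (hR : R.IsLowerTriangular) (hRu : IsUnit R) :
    ∑ i, (‖R i i‖ ^ 2) ^ q ≤ reTrace (matPow (Rᴴ * R) q) := by
  obtain ⟨k, hk⟩ := exists_nat_ge q⁻¹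
  refine weyl_le_of_inv_le k hq ?_ hR hRu
  have := mul_le_mul_of_nonneg_right hk hq.le
  rw [inv_mul_cancel₀ hq.ne'] at this
  linarith

lemma rpow_mul_le_add {u v q r t : ℝ} (hu : 0 ≤ u) (hv : 0 ≤ v) (hq : 0 < q) (hr : 0 < r)
    (ht : 0 < t) (h : q⁻¹ = r⁻¹ + t⁻¹) :
    q⁻¹ * (u * v) ^ q ≤ r⁻¹ * u ^ r + t⁻¹ * v ^ t := by
  have hw : q / r + q / t = 1 := by
    rw [div_eq_mul_inv, div_eq_mul_inv, ← mul_add, ← h, mul_inv_cancel₀ hq.ne']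
  have h' := Real.geom_mean_le_arith_mean2_weighted (by positivity) (by positivity)
    (Real.rpow_nonneg hu r) (Real.rpow_nonneg hv t) hw
  rw [← Real.rpow_mul hu, ← Real.rpow_mul hv, mul_div_cancel₀ _ hr.ne', mul_div_cancel₀ _ ht.ne',
    ← Real.mul_rpow hu hv] at h'
  refine (mul_le_mul_of_nonneg_left h' (inv_nonneg.mpr hq.le)).trans (le_of_eq ?_)
  field_simp

end Triangular

section Hoelder

variable {n : ℕ}

lemma reTrace_young_of_isUnit {q r t : ℝ} (hq : 0 < q) (hr : 0 < r) (ht : 0 < t)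
    (h : q⁻¹ = r⁻¹ + t⁻¹) {X B : Matrix (Fin n) (Fin n) ℂ} (hX : IsUnit X) (hB : B.PosDef) :
    q⁻¹ * reTrace (matPow (Xᴴ * B * X) q) ≤
      r⁻¹ * reTrace (matPow B r) + t⁻¹ * reTrace (matPow (Xᴴ * X) t) := by
  have hXdet := (Matrix.isUnit_iff_isUnit_det _).mp hX
  have hM : (Xᴴ * B * X).PosDef :=
    hB.conjTranspose_mul_mul_same (Matrix.mulVec_injective_of_isUnit hX)
  set c := hM.1.eigenvalues with hc
  have hcpos : ∀ i, 0 < c i := hM.eigenvalues_pos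
  obtain ⟨V, hV₁, hV₂, hVM⟩ : ∃ V : Matrix (Fin n) (Fin n) ℂ, V * Vᴴ = 1 ∧ Vᴴ * V = 1 ∧
      V * diagonal (fun i => (c i : ℂ)) * Vᴴ = Xᴴ * B * X := by
    refine ⟨hM.1.eigenvectorUnitary, mem_unitaryGroup_iff.mp hM.1.eigenvectorUnitary.2,
      mem_unitaryGroup_iff'.mp hM.1.eigenvectorUnitary.2, ?_⟩
    conv_rhs => rw [hM.1.spectral_theorem, Unitary.conjStarAlgAut_apply]
    rfl
  have hVu : IsUnit V := IsUnit.of_mul_eq_one _ hV₁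
  set Y := X * V with hY
  have hYu : IsUnit Y := hX.mul hVu
  have hYdet := (Matrix.isUnit_iff_isUnit_det _).mp hYu
  have hN : (Yᴴ * Y).PosDef :=
    PosDef.conjTranspose_mul_self Y (Matrix.mulVec_injective_of_isUnit hYu)
  obtain ⟨S, hS, hSu, hSN⟩ := exists_isLowerTriangular_mul_conjTranspose hN.inv
  have hSu' : IsUnit S⁻¹ := (Matrix.isUnit_nonsing_inv_iff).mpr hSu
  set d : Matrix (Fin n) (Fin n) ℂ := diagonal fun i => (Real.sqrt (c i) : ℂ) with hd
  have hdd : d * d = diagonal fun i => (c i : ℂ) := by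
    rw [hd, diagonal_mul_diagonal]
    congr 1
    ext i
    rw [← Complex.ofReal_mul, Real.mul_self_sqrt (hcpos i).le]
  have hdH : dᴴ = d := by
    rw [hd, diagonal_conjTranspose]
    congr 1
    ext i
    simp
  have hdu : IsUnit d := isUnit_of_mul_isUnit_left (y := d) (by
    rw [hdd, Matrix.isUnit_diagonal, Pi.isUnit_iff]
    exact fun i => (Complex.ofReal_ne_zero.mpr (hcpos i).ne').isUnit)
  have hdS : (d * S).IsLowerTriangular :=
    BlockTriangular.mul (blockTriangular_diagonal _) hS
  have hleft : reTrace (matPow (Xᴴ * B * X) q) = ∑ i, c i ^ q := reTrace_matPow hM.1 hq.ne'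
  have hYM : Yᴴ * B * Y = d * d := by
    calc Yᴴ * B * Y = Vᴴ * (Xᴴ * B * X) * V := by
          rw [hY, conjTranspose_mul]; simp only [mul_assoc]
      _ = (Vᴴ * V) * diagonal (fun i => (c i : ℂ)) * (Vᴴ * V) := by
          rw [← hVM]; simp only [mul_assoc]
      _ = d * d := by rw [hV₂, one_mul, mul_one, hdd]
  have hright₁ : ∑ i, (c i * ‖S i i‖ ^ 2) ^ r ≤ reTrace (matPow B r) := by
    have hw := sum_norm_sq_rpow_le_reTrace hr hdS (hdu.mul hSu)
    have hB' : (d * Y⁻¹)ᴴ * (d * Y⁻¹) = B := by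
      rw [conjTranspose_mul, hdH, mul_assoc, ← mul_assoc d d, ← hYM, conjTranspose_nonsing_inv,
        mul_assoc, Matrix.mul_nonsing_inv _ hYdet, mul_one, Matrix.nonsing_inv_mul_cancel_left]
      rwa [det_conjTranspose, isUnit_star]
    rw [reTrace_matPow_conjTranspose_mul_self, conjTranspose_mul, mul_assoc, ← mul_assoc S, hSN,
      Matrix.mul_inv_rev, ← conjTranspose_nonsing_inv, mul_assoc, ← conjTranspose_mul, ← mul_assoc,
      ← reTrace_matPow_conjTranspose_mul_self, hB'] at hw
    refine le_trans (le_of_eq (Finset.sum_congr rfl fun i _ => ?_)) hw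
    rw [hd, diagonal_mul, norm_mul, mul_pow, Complex.norm_real, Real.norm_eq_abs, sq_abs,
      Real.sq_sqrt (hcpos i).le]
  have hright₂ : ∑ i, ((‖S i i‖ ^ 2)⁻¹) ^ t ≤ reTrace (matPow (Xᴴ * X) t) := by
    have hw := sum_norm_sq_rpow_le_reTrace ht (isLowerTriangular_inv hS hSu) hSu'
    have hXX : Y * Yᴴ = X * Xᴴ := by
      rw [hY, conjTranspose_mul, mul_assoc, ← mul_assoc V, hV₁, one_mul]
    rw [conjTranspose_nonsing_inv, ← Matrix.mul_inv_rev, hSN,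
      Matrix.nonsing_inv_nonsing_inv _ ((Matrix.isUnit_iff_isUnit_det _).mp hN.isUnit),
      reTrace_matPow_conjTranspose_mul_self, hXX, ← reTrace_matPow_conjTranspose_mul_self] at hw
    refine le_trans (le_of_eq (Finset.sum_congr rfl fun i _ => ?_)) hw
    rw [eq_inv_of_mul_eq_one_right (apply_self_mul_inv_apply_self hS hSu i), norm_inv, inv_pow]
  calc q⁻¹ * reTrace (matPow (Xᴴ * B * X) q)
      = ∑ i, q⁻¹ * (c i * ‖S i i‖ ^ 2 * (‖S i i‖ ^ 2)⁻¹) ^ q := by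
        rw [hleft, Finset.mul_sum]
        refine Finset.sum_congr rfl fun i _ => ?_
        have hne := left_ne_zero_of_mul_eq_one (apply_self_mul_inv_apply_self hS hSu i)
        rw [mul_assoc, mul_inv_cancel₀ (by positivity), mul_one]
    _ ≤ ∑ i, (r⁻¹ * (c i * ‖S i i‖ ^ 2) ^ r + t⁻¹ * ((‖S i i‖ ^ 2)⁻¹) ^ t) :=
        Finset.sum_le_sum fun i _ => rpow_mul_le_add
          (mul_nonneg (hcpos i).le (by positivity)) (by positivity) hq hr ht h
    _ ≤ r⁻¹ * reTrace (matPow B r) + t⁻¹ * reTrace (matPow (Xᴴ * X) t) := by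
        rw [Finset.sum_add_distrib, ← Finset.mul_sum, ← Finset.mul_sum]
        gcongr

/-- Young's form of the Schatten–Hölder inequality, for arbitrary positive exponents. -/
lemma reTrace_young {q r t : ℝ} (hq : 0 < q) (hr : 0 < r) (ht : 0 < t)
    (h : q⁻¹ = r⁻¹ + t⁻¹) (X : Matrix (Fin n) (Fin n) ℂ) {B : Matrix (Fin n) (Fin n) ℂ}
    (hB : B.PosSemidef) :
    q⁻¹ * reTrace (matPow (Xᴴ * B * X) q) ≤
      r⁻¹ * reTrace (matPow B r) + t⁻¹ * reTrace (matPow (Xᴴ * X) t) := by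
  let X' : ℝ → Matrix (Fin n) (Fin n) ℂ := fun e => X + (e : ℂ) • 1
  let B' : ℝ → Matrix (Fin n) (Fin n) ℂ := fun e => B + (e : ℂ) • 1
  have hX' : Continuous X' := by fun_prop
  have hB' : Continuous B' := by fun_prop
  have hBh : ∀ e, (B' e).IsHermitian := fun e =>
    hB.1.add (by simp [Matrix.IsHermitian, conjTranspose_smul])
  have h₁ : Continuous fun e => q⁻¹ * reTrace (matPow ((X' e)ᴴ * B' e * X' e) q) :=
    (continuous_reTrace_matPow ((hX'.matrix_conjTranspose.mul hB').mul hX')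
      (fun e => isHermitian_conjTranspose_mul_mul _ (hBh e)) hq).const_mul _
  have h₂ : Continuous fun e =>
      r⁻¹ * reTrace (matPow (B' e) r) + t⁻¹ * reTrace (matPow ((X' e)ᴴ * X' e) t) :=
    ((continuous_reTrace_matPow hB' hBh hr).const_mul _).add
      ((continuous_reTrace_matPow (hX'.matrix_conjTranspose.mul hX')
        (fun e => isHermitian_conjTranspose_mul_self _) ht).const_mul _)
  have hev : ∀ᶠ e in 𝓝[>] (0 : ℝ),
      q⁻¹ * reTrace (matPow ((X' e)ᴴ * B' e * X' e) q) ≤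
        r⁻¹ * reTrace (matPow (B' e) r) + t⁻¹ * reTrace (matPow ((X' e)ᴴ * X' e) t) := by
    have hfin : {e : ℝ | (e : ℂ) ∈ spectrum ℂ (-X)}.Finite :=
      (Matrix.finite_spectrum (-X)).preimage Complex.ofReal_injective.injOn
    have hne : ∀ᶠ e in 𝓝[>] (0 : ℝ), e ∉ {e : ℝ | (e : ℂ) ∈ spectrum ℂ (-X)} := by
      have hd : {e : ℝ | (e : ℂ) ∈ spectrum ℂ (-X)}ᶜ ∈ 𝓝[≠] (0 : ℝ) := by
        have hc := (hfin.subset (Set.sdiff_subset (t := {0}))).isClosed.isOpen_compl.mem_nhds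
          (show (0 : ℝ) ∈ ({e : ℝ | (e : ℂ) ∈ spectrum ℂ (-X)} \ {0})ᶜ by simp)
        filter_upwards [mem_nhdsWithin_of_mem_nhds hc, self_mem_nhdsWithin] with e he he0 he'
        exact he ⟨he', he0⟩
      exact nhdsWithin_mono _ (fun e he => (Set.mem_Ioi.mp he).ne') hd
    filter_upwards [hne, self_mem_nhdsWithin] with e he he0
    refine reTrace_young_of_isUnit hq hr ht h ?_ ?_
    · have hu := spectrum.notMem_iff.mp he
      rwa [sub_neg_eq_add, Algebra.algebraMap_eq_smul_one, add_comm] at hu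
    · refine PosDef.posSemidef_add hB ?_
      exact PosDef.one.smul (by simpa using he0)
  have hlim := le_of_tendsto_of_tendsto (h₁.continuousAt.tendsto.mono_left nhdsWithin_le_nhds)
    (h₂.continuousAt.tendsto.mono_left nhdsWithin_le_nhds) hev
  simpa [X', B'] using hlim

end Hoelder

section Variational

variable {n : ℕ} {ρ σ : Matrix (Fin n) (Fin n) ℂ} {α z lam : ℝ}

lemma supportProj_mul_matPow (hσ : σ.PosSemidef) (x : ℝ) :
    matPow σ 0 * matPow σ x = matPow σ x := by
  rw [matPow_mul_matPow hσ, zero_add]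

lemma matPow_zero_le_one (hσ : σ.PosSemidef) : matPow σ 0 ≤ 1 := by
  rw [matPow_eq_cfc hσ.1]
  refine cfc_le_one _ _ fun t _ => ?_
  unfold supportPow
  split_ifs <;> simp

/-- Domination by a multiple of a power of `σ` forces the support inclusion. -/
lemma supportProj_mul_of_le {a : Matrix (Fin n) (Fin n) ℂ} (hσ : σ.PosSemidef) {x : ℝ}
    (h : a * aᴴ ≤ lam • matPow σ x) : matPow σ 0 * a = a := by
  obtain ⟨P, hP⟩ : ∃ P, P = 1 - matPow σ 0 := ⟨_, rfl⟩
  have hPH : Pᴴ = P := by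
    rw [hP, conjTranspose_sub, conjTranspose_one, (posSemidef_matPow hσ 0).1]
  have hPσ : P * matPow σ x = 0 := by
    rw [hP, sub_mul, one_mul, supportProj_mul_matPow hσ, sub_self]
  have h0 : (P * a) * (P * a)ᴴ ≤ 0 := by
    have hc : (Pᴴ * (lam • matPow σ x - a * aᴴ) * P).PosSemidef :=
      PosSemidef.conjTranspose_mul_mul_same h P
    rw [hPH, mul_sub, mul_smul_comm, hPσ, smul_zero] at hc
    rw [Matrix.le_iff, conjTranspose_mul, hPH]
    simpa [sub_mul, mul_assoc] using hc
  have h1 : (P * a) * (P * a)ᴴ = 0 :=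
    le_antisymm h0 (nonneg_iff_posSemidef.mpr (posSemidef_self_mul_conjTranspose _))
  have h2 : P * a = 0 := Matrix.self_mul_conjTranspose_eq_zero.mp h1
  rw [hP, sub_mul, one_mul, sub_eq_zero] at h2
  exact h2.symm

/-- The maximizer in the variational formula for `Q_{α,z}`. -/
def optimalH (α z : ℝ) (ρ σ : Matrix (Fin n) (Fin n) ℂ) : Matrix (Fin n) (Fin n) ℂ :=
  matPow σ ((1 - α) / (2 * z)) * matPow (matPow σ ((1 - α) / (2 * z)) * matPow ρ (α / z) *
    matPow σ ((1 - α) / (2 * z))) (α - 1) * matPow σ ((1 - α) / (2 * z))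

lemma matPow_half_mul_self (hρ : ρ.PosSemidef) (α z : ℝ) :
    matPow ρ (α / (2 * z)) * matPow ρ (α / (2 * z)) = matPow ρ (α / z) := by
  rw [matPow_mul_matPow hρ]
  congr 1
  rw [← two_mul, mul_div_assoc', mul_div_mul_left _ _ two_ne_zero]

lemma posSemidef_optimalH (hρ : ρ.PosSemidef) (hσ : σ.PosSemidef) :
    (optimalH α z ρ σ).PosSemidef := by
  have hs := (posSemidef_matPow hσ ((1 - α) / (2 * z))).1
  have h := (posSemidef_matPow hρ (α / z)).mul_mul_conjTranspose_same
    (matPow σ ((1 - α) / (2 * z)))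
  rw [hs] at h
  have h' := (posSemidef_matPow h (α - 1)).mul_mul_conjTranspose_same
    (matPow σ ((1 - α) / (2 * z)))
  rwa [hs] at h'

lemma supportProj_mul_matPow_half (hρ : ρ.PosSemidef) (hσ : σ.PosSemidef)
    (hle : matPow ρ (α / z) ≤ lam • matPow σ (α / z)) :
    matPow σ 0 * matPow ρ (α / (2 * z)) = matPow ρ (α / (2 * z)) := by
  refine supportProj_mul_of_le (lam := lam) (x := α / z) hσ ?_
  rwa [(posSemidef_matPow hρ _).1, matPow_half_mul_self hρ]

/-- The upper bound in the variational formula. -/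
lemma varF_le_Qaz (hρ : ρ.PosSemidef) (hσ : σ.PosSemidef) (hα : 1 < α) (hz : 0 < z)
    (hle : matPow ρ (α / z) ≤ lam • matPow σ (α / z))
    {H : Matrix (Fin n) (Fin n) ℂ} (hH : H.PosSemidef) :
    varF α z ρ σ H ≤ Qaz α z ρ σ := by
  have hPa := supportProj_mul_matPow_half hρ hσ hle
  have haa := matPow_half_mul_self hρ α z
  have haH := (posSemidef_matPow hρ (α / (2 * z))).1
  have hsH := (posSemidef_matPow hσ ((α - 1) / (2 * z))).1
  have hsH' := (posSemidef_matPow hσ ((1 - α) / (2 * z))).1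
  have hss : matPow σ ((α - 1) / (2 * z)) * matPow σ ((1 - α) / (2 * z)) = matPow σ 0 := by
    rw [matPow_mul_matPow hσ]; congr 1; ring
  have hss' : matPow σ ((1 - α) / (2 * z)) * matPow σ ((α - 1) / (2 * z)) = matPow σ 0 := by
    rw [matPow_mul_matPow hσ]; congr 1; ring
  unfold varF Qaz
  rw [← haa]
  generalize matPow ρ (α / (2 * z)) = a at *
  generalize matPow σ ((α - 1) / (2 * z)) = s at *
  generalize matPow σ ((1 - α) / (2 * z)) = s' at *
  have haP : a * matPow σ 0 = a := by
    have := congrArg conjTranspose hPa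
    rwa [conjTranspose_mul, haH, (posSemidef_matPow hσ 0).1] at this
  have hB : (s * H * s).PosSemidef := by
    have := hH.mul_mul_conjTranspose_same s
    rwa [hsH] at this
  have hα1 : 0 < α - 1 := by linarith
  have hy := reTrace_young (q := z / α) (r := z / (α - 1)) (t := z) (by positivity) (by positivity)
    hz (by field_simp; ring) (s' * a) hB
  have hX : (s' * a)ᴴ * (s * H * s) * (s' * a) = a * H * a := by
    calc (s' * a)ᴴ * (s * H * s) * (s' * a) = a * (s' * s) * H * ((s * s') * a) := by
          rw [conjTranspose_mul, hsH', haH]; simp only [mul_assoc]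
      _ = a * H * a := by rw [hss, hss', haP, hPa]
  have hXX : (s' * a) * (s' * a)ᴴ = s' * (a * a) * s' := by
    rw [conjTranspose_mul, hsH', haH]; simp only [mul_assoc]
  rw [hX, reTrace_matPow_conjTranspose_mul_self, hXX, inv_div, inv_div, div_mul_eq_mul_div,
    div_mul_eq_mul_div, inv_mul_eq_div, ← add_div, div_le_div_iff_of_pos_right hz] at hy
  linarith

lemma matPow_mul_optimalH_mul_matPow (hρ : ρ.PosSemidef) (hσ : σ.PosSemidef) :
    matPow σ ((α - 1) / (2 * z)) * optimalH α z ρ σ * matPow σ ((α - 1) / (2 * z)) =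
      matPow (matPow σ ((1 - α) / (2 * z)) * matPow ρ (α / z) *
        matPow σ ((1 - α) / (2 * z))) (α - 1) := by
  have hss : matPow σ ((α - 1) / (2 * z)) * matPow σ ((1 - α) / (2 * z)) = matPow σ 0 := by
    rw [matPow_mul_matPow hσ]; congr 1; ring
  have hss' : matPow σ ((1 - α) / (2 * z)) * matPow σ ((α - 1) / (2 * z)) = matPow σ 0 := by
    rw [matPow_mul_matPow hσ]; congr 1; ring
  have hPs' := supportProj_mul_matPow hσ ((1 - α) / (2 * z))
  have hs'P : matPow σ ((1 - α) / (2 * z)) * matPow σ 0 = matPow σ ((1 - α) / (2 * z)) := by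
    rw [matPow_mul_matPow hσ, add_zero]
  have hKpsd := (posSemidef_matPow hρ (α / z)).mul_mul_conjTranspose_same
    (matPow σ ((1 - α) / (2 * z)))
  rw [(posSemidef_matPow hσ _).1] at hKpsd
  unfold optimalH
  generalize matPow ρ (α / z) = b at *
  generalize matPow σ ((α - 1) / (2 * z)) = s at *
  generalize matPow σ ((1 - α) / (2 * z)) = s' at *
  have hPK : matPow σ 0 * (s' * b * s') = s' * b * s' := by
    rw [← mul_assoc, ← mul_assoc, hPs']
  have hKP : s' * b * s' * matPow σ 0 = s' * b * s' := by
    rw [mul_assoc, hs'P]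
  generalize s' * b * s' = K at *
  have hl := matPow_mul_matPow hKpsd 1 (α - 2)
  have hr := matPow_mul_matPow hKpsd (α - 2) 1
  rw [matPow_one hKpsd, show 1 + (α - 2) = α - 1 by ring] at hl
  rw [matPow_one hKpsd, show α - 2 + 1 = α - 1 by ring] at hr
  calc s * (s' * matPow K (α - 1) * s') * s
      = (s * s') * matPow K (α - 1) * (s' * s) := by simp only [mul_assoc]
    _ = matPow K (α - 1) := by
        rw [hss, hss', ← hl, ← mul_assoc, hPK, hl, ← hr, mul_assoc, hKP]

/-- The optimal operator attains the value `Q_{α,z}`. -/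
lemma varF_optimalH (hρ : ρ.PosSemidef) (hσ : σ.PosSemidef) (hα : 1 < α) :
    varF α z ρ σ (optimalH α z ρ σ) = Qaz α z ρ σ := by
  have haH := (posSemidef_matPow hρ (α / (2 * z))).1
  have hsH' := (posSemidef_matPow hσ ((1 - α) / (2 * z))).1
  unfold varF Qaz
  rw [matPow_mul_optimalH_mul_matPow hρ hσ]
  unfold optimalH
  rw [← matPow_half_mul_self hρ α z]
  generalize matPow ρ (α / (2 * z)) = a at *
  generalize matPow σ ((1 - α) / (2 * z)) = s' at *
  have hK : s' * (a * a) * s' = (a * s')ᴴ * (a * s') := by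
    rw [conjTranspose_mul, hsH', haH]; simp only [mul_assoc]
  rw [hK]
  have h₁ : a * (s' * matPow ((a * s')ᴴ * (a * s')) (α - 1) * s') * a =
      matPow ((a * s') * (a * s')ᴴ) α := by
    have hpow := matPow_mul_matPow (posSemidef_self_mul_conjTranspose (a * s')) (α - 1) 1
    rw [matPow_one (posSemidef_self_mul_conjTranspose (a * s')), sub_add_cancel] at hpow
    rw [← hpow, ← mul_assoc (matPow _ _), ← mul_matPow_conjTranspose_mul_self,
      conjTranspose_mul (a), hsH', haH]
    simp only [mul_assoc]
  rw [h₁, matPow_matPow (posSemidef_self_mul_conjTranspose _),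
    matPow_matPow (posSemidef_conjTranspose_mul_self _),
    mul_div_cancel₀ _ (by linarith), mul_div_cancel₀ _ (by linarith),
    reTrace_matPow_conjTranspose_mul_self]
  ring

lemma optimalH_ne_zero (hρ : ρ.PosSemidef) (hρ0 : ρ ≠ 0) (hσ : σ.PosSemidef)
    (hle : matPow ρ (α / z) ≤ lam • matPow σ (α / z)) : optimalH α z ρ σ ≠ 0 := by
  intro h0
  have hss : matPow σ ((α - 1) / (2 * z)) * matPow σ ((1 - α) / (2 * z)) = matPow σ 0 := by
    rw [matPow_mul_matPow hσ]; congr 1; ring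
  have hss' : matPow σ ((1 - α) / (2 * z)) * matPow σ ((α - 1) / (2 * z)) = matPow σ 0 := by
    rw [matPow_mul_matPow hσ]; congr 1; ring
  have hKpsd := (posSemidef_matPow hρ (α / z)).mul_mul_conjTranspose_same
    (matPow σ ((1 - α) / (2 * z)))
  rw [(posSemidef_matPow hσ _).1] at hKpsd
  have hK := matPow_mul_matPow hKpsd (α - 1) (2 - α)
  rw [← matPow_mul_optimalH_mul_matPow hρ hσ, h0, mul_zero, zero_mul, zero_mul,
    show α - 1 + (2 - α) = 1 by ring, matPow_one hKpsd] at hK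
  have hPb : matPow σ 0 * matPow ρ (α / z) = matPow ρ (α / z) := by
    rw [← matPow_half_mul_self hρ, ← mul_assoc, supportProj_mul_matPow_half hρ hσ hle]
  have hbP : matPow ρ (α / z) * matPow σ 0 = matPow ρ (α / z) := by
    have := congrArg conjTranspose hPb
    rwa [conjTranspose_mul, (posSemidef_matPow hρ _).1, (posSemidef_matPow hσ 0).1] at this
  have hb : matPow ρ (α / z) = 0 := by
    calc matPow ρ (α / z)
        = (matPow σ ((α - 1) / (2 * z)) * matPow σ ((1 - α) / (2 * z))) * matPow ρ (α / z) *
          (matPow σ ((1 - α) / (2 * z)) * matPow σ ((α - 1) / (2 * z))) := by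
          rw [hss, hss', hPb, hbP]
      _ = matPow σ ((α - 1) / (2 * z)) * (matPow σ ((1 - α) / (2 * z)) * matPow ρ (α / z) *
          matPow σ ((1 - α) / (2 * z))) * matPow σ ((α - 1) / (2 * z)) := by
          simp only [mul_assoc]
      _ = 0 := by rw [← hK, mul_zero, zero_mul]
  have h1 := matPow_mul_matPow hρ (α / z) (1 - α / z)
  rw [hb, zero_mul, add_sub_cancel, matPow_one hρ] at h1
  exact hρ0 h1.symm

lemma optimalH_le (hρ : ρ.PosSemidef) (hσ : σ.PosSemidef) (hα : 1 < α) (hα2 : α ≤ 2)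
    (hlam : 0 < lam) (hle : matPow ρ (α / z) ≤ lam • matPow σ (α / z)) :
    optimalH α z ρ σ ≤ lam ^ (α - 1) • (1 : Matrix (Fin n) (Fin n) ℂ) := by
  have hsH := (posSemidef_matPow hσ ((1 - α) / (2 * z))).1
  have hconj : ∀ {A B : Matrix (Fin n) (Fin n) ℂ}, A ≤ B →
      matPow σ ((1 - α) / (2 * z)) * A * matPow σ ((1 - α) / (2 * z)) ≤
        matPow σ ((1 - α) / (2 * z)) * B * matPow σ ((1 - α) / (2 * z)) := by
    intro A B hAB
    have h := PosSemidef.mul_mul_conjTranspose_same hAB (matPow σ ((1 - α) / (2 * z)))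
    rw [hsH, mul_sub, sub_mul] at h
    exact h
  have hσpow : ∀ x y w : ℝ, x + y + x = w → matPow σ x * matPow σ y * matPow σ x = matPow σ w := by
    rintro x y _ rfl
    rw [matPow_mul_matPow hσ, matPow_mul_matPow hσ]
  have h₁ := hconj hle
  rw [mul_smul_comm, smul_mul_assoc, hσpow _ _ (1 / z) (by ring)] at h₁
  have hl := (posSemidef_matPow hρ (α / z)).mul_mul_conjTranspose_same
    (matPow σ ((1 - α) / (2 * z)))
  rw [hsH] at hl
  have h₂ := hconj (matPow_le_matPow hl ((posSemidef_matPow hσ (1 / z)).smul hlam.le) h₁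
    (by linarith) (show α - 1 ≤ 1 by linarith))
  rw [matPow_smul_matPow hσ _ _ hlam, mul_smul_comm, smul_mul_assoc, hσpow _ _ 0 (by ring)] at h₂
  refine h₂.trans ?_
  rw [Matrix.le_iff, ← smul_sub]
  exact PosSemidef.smul (matPow_zero_le_one hσ) (Real.rpow_nonneg hlam.le _)

lemma optimalH_le_max (hρ : ρ.PosSemidef) (hσ : σ.PosSemidef) (hα : 1 < α) (hα2 : α ≤ 2)
    (hlam : 0 < lam) (hle : matPow ρ (α / z) ≤ lam • matPow σ (α / z)) :
    optimalH α z ρ σ ≤ max 1 lam • (1 : Matrix (Fin n) (Fin n) ℂ) := by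
  have hpow : lam ^ (α - 1) ≤ max 1 lam := by
    rcases le_total lam 1 with h | h
    · exact (Real.rpow_le_one hlam.le h (by linarith)).trans (le_max_left _ _)
    · exact (Real.rpow_le_self_of_one_le h (by linarith)).trans (le_max_right _ _)
  refine (optimalH_le hρ hσ hα hα2 hlam hle).trans ?_
  rw [Matrix.le_iff, ← sub_smul]
  exact PosSemidef.one.smul (sub_nonneg.mpr hpow)

end Variational

end Auxiliary

/-- Variational formula: under `ρ^{α/z} ≤ λ σ^{α/z}` with `α ∈ (1,2]`,
`Q_{α,z}(ρ‖σ)` is the maximum of the functional `H ↦ varF α z ρ σ H` over all nonzero PSD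
`H`, over `0 ≤ H ≤ max{1,λ}·I`, and over `0 ≤ H ≤ λ^{α-1}·I`. -/
theorem Qaz_variational_formula {n : ℕ} (ρ σ : Matrix (Fin n) (Fin n) ℂ)
    (hρ : PSDne ρ) (hσ : PSDne σ) (α z lam : ℝ) (hα : 1 < α) (hα2 : α ≤ 2)
    (hz : 0 < z) (hlam : 0 < lam)
    (hle : loewnerLE (matPow ρ (α / z)) (lam • matPow σ (α / z))) :
    IsGreatest {y : ℝ | ∃ H : Matrix (Fin n) (Fin n) ℂ, H.PosSemidef ∧ H ≠ 0 ∧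
        y = varF α z ρ σ H} (Qaz α z ρ σ) ∧
    IsGreatest {y : ℝ | ∃ H : Matrix (Fin n) (Fin n) ℂ, H.PosSemidef ∧
        loewnerLE H ((max 1 lam) • (1 : Matrix (Fin n) (Fin n) ℂ)) ∧
        y = varF α z ρ σ H} (Qaz α z ρ σ) ∧
    IsGreatest {y : ℝ | ∃ H : Matrix (Fin n) (Fin n) ℂ, H.PosSemidef ∧
        loewnerLE H ((lam ^ (α - 1)) • (1 : Matrix (Fin n) (Fin n) ℂ)) ∧
        y = varF α z ρ σ H} (Qaz α z ρ σ) := by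
  have hmax := fun H hH => varF_le_Qaz hρ.1 hσ.1 hα hz hle (H := H) hH
  have hval := (varF_optimalH (z := z) hρ.1 hσ.1 hα).symm
  have hpsd := posSemidef_optimalH (α := α) (z := z) hρ.1 hσ.1
  refine ⟨⟨⟨_, hpsd, optimalH_ne_zero hρ.1 hρ.2 hσ.1 hle, hval⟩, ?_⟩,
    ⟨⟨_, hpsd, optimalH_le_max hρ.1 hσ.1 hα hα2 hlam hle, hval⟩, ?_⟩,
    ⟨⟨_, hpsd, optimalH_le hρ.1 hσ.1 hα hα2 hlam hle, hval⟩, ?_⟩⟩ <;>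
  · rintro _ ⟨H, hH, _, rfl⟩
    exact hmax H hH

end QRenyi

end
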